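/- Fix σ > 0, set c = β η_dec²/η_enc², and let ζ_max denote the largest singular value of Z ∈ ℝ^{d2×d0}. Define the quadratic form Q(ΔU, ΔV) = σ²‖ΔU‖_F² − 2 Tr(Z ΔV ΔUᵀ) + c‖ΔV‖_F² for ΔU ∈ ℝ^{d2×d1}, ΔV ∈ ℝ^{d0×d1}. Then Q(ΔU, ΔV) ≥ 0 for all (ΔU, ΔV) if and only if ζ_max² ≤ σ² c; equivalently, if and only if σ² + c − sqrt((σ² − c)² + 4 ζ_max²) ≥ 0. -/

import Mathlib

open Matrix BigOperators

noncomputable def frobSq {m n : ℕ} (M : Matrix (Fin m) (Fin n) ℝ) : ℝ :=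
  ∑ i, ∑ j, (M i j) ^ 2

theorem frobSq_eq_trace {m n : ℕ} (M : Matrix (Fin m) (Fin n) ℝ) :
    frobSq M = Matrix.trace (Mᵀ * M) := by
  simp only [frobSq, Matrix.trace, Matrix.diag, Matrix.mul_apply, Matrix.transpose_apply]
  rw [Finset.sum_comm]
  simp only [sq]

theorem frobSq_orth {m n : ℕ} (F : Matrix (Fin m) (Fin m) ℝ) (hF : Fᵀ * F = 1)
    (M : Matrix (Fin m) (Fin n) ℝ) : frobSq (F * M) = frobSq M := by
  rw [frobSq_eq_trace, frobSq_eq_trace, Matrix.transpose_mul, Matrix.mul_assoc,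
    ← Matrix.mul_assoc Fᵀ, hF, Matrix.one_mul]

theorem sum_ind_le {m : ℕ} (i : ℕ) (x : ℝ) (hx : 0 ≤ x) :
    ∑ j : Fin m, (if i = (j : ℕ) then x else 0) ≤ x := by
  by_cases h : i < m
  · have : ∀ j : Fin m, (i = (j : ℕ)) ↔ ((⟨i, h⟩ : Fin m) = j) := by
      intro j; simp [Fin.ext_iff]
    simp [this]
  · have : ∀ j : Fin m, ¬ (i = (j : ℕ)) := by
      intro j hj; have := j.2; omega
    simp [this, hx]

theorem diag_bound {p q : ℕ} (ζ : ℕ → ℝ) (s c : ℝ) (hs : 0 ≤ s) (hc : 0 ≤ c)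
    (h : ∀ i, ∀ x y : ℝ, 2 * (ζ i * y * x) ≤ s * x ^ 2 + c * y ^ 2)
    (a : Fin p → ℝ) (b : Fin q → ℝ) :
    2 * ∑ i : Fin p, (∑ j : Fin q, (if (i : ℕ) = (j : ℕ) then ζ i else 0) * b j) * a i
      ≤ s * ∑ i, a i ^ 2 + c * ∑ j, b j ^ 2 := by
  have h1 : ∑ i : Fin p, ∑ j : Fin q, (if (i : ℕ) = (j : ℕ) then s * a i ^ 2 else 0)
      ≤ s * ∑ i, a i ^ 2 := by
    rw [Finset.mul_sum]
    exact Finset.sum_le_sum fun i _ => sum_ind_le _ _ (by positivity)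
  have h2 : ∑ i : Fin p, ∑ j : Fin q, (if (i : ℕ) = (j : ℕ) then c * b j ^ 2 else 0)
      ≤ c * ∑ j, b j ^ 2 := by
    rw [Finset.mul_sum, Finset.sum_comm]
    refine Finset.sum_le_sum fun j _ => ?_
    simp only [eq_comm (b := (j : ℕ))]
    exact sum_ind_le _ _ (by positivity)
  refine le_trans ?_ (add_le_add h1 h2)
  rw [← Finset.sum_add_distrib, Finset.mul_sum]
  refine Finset.sum_le_sum fun i _ => ?_
  rw [← Finset.sum_add_distrib, Finset.sum_mul, Finset.mul_sum]
  refine Finset.sum_le_sum fun j _ => ?_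
  split_ifs
  · exact h _ _ _
  · simp

/-- positive semidefiniteness of the Hessian quadratic form at the
origin, in terms of the largest singular value of `Z`. -/
theorem hessian_quadratic_form_psd_iff
    (d0 d1 d2 : ℕ) (hd0 : 1 ≤ d0) (hd1 : 1 ≤ d1) (hd2 : 1 ≤ d2)
    (β ηenc ηdec σ : ℝ) (hβ : 0 < β) (henc : 0 < ηenc) (hdec : 0 < ηdec)
    (hσ : 0 < σ)
    (c : ℝ) (hc : c = β * ηdec ^ 2 / ηenc ^ 2)
    (ζ : ℕ → ℝ) (hζmono : ∀ i j, i ≤ j → ζ j ≤ ζ i) (hζnn : ∀ i, 0 ≤ ζ i)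
    (hζzero : ∀ i, min d0 d2 ≤ i → ζ i = 0)
    (F : Matrix (Fin d2) (Fin d2) ℝ) (G : Matrix (Fin d0) (Fin d0) ℝ)
    (hF : Fᵀ * F = 1) (hF' : F * Fᵀ = 1) (hG : Gᵀ * G = 1) (hG' : G * Gᵀ = 1)
    (Z : Matrix (Fin d2) (Fin d0) ℝ)
    (hZ : Z = F * (Matrix.of fun (i : Fin d2) (j : Fin d0) =>
        if (i : ℕ) = (j : ℕ) then ζ i else 0) * Gᵀ)
    (Q : Matrix (Fin d2) (Fin d1) ℝ → Matrix (Fin d0) (Fin d1) ℝ → ℝ)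
    (hQ : ∀ ΔU ΔV, Q ΔU ΔV = σ ^ 2 * frobSq ΔU
        - 2 * Matrix.trace (Z * ΔV * ΔUᵀ) + c * frobSq ΔV) :
    ((∀ ΔU ΔV, 0 ≤ Q ΔU ΔV) ↔ ζ 0 ^ 2 ≤ σ ^ 2 * c)
    ∧ ((∀ ΔU ΔV, 0 ≤ Q ΔU ΔV) ↔
        0 ≤ σ ^ 2 + c - Real.sqrt ((σ ^ 2 - c) ^ 2 + 4 * ζ 0 ^ 2)) := by
  have hcpos : 0 < c := by rw [hc]; positivity
  have hs : 0 < σ ^ 2 := by positivity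
  set S : Matrix (Fin d2) (Fin d0) ℝ := Matrix.of fun (i : Fin d2) (j : Fin d0) =>
        if (i : ℕ) = (j : ℕ) then ζ i else 0 with hS
  have key : ∀ (A : Matrix (Fin d2) (Fin d1) ℝ) (B : Matrix (Fin d0) (Fin d1) ℝ), Q (F * A) (G * B) = σ ^ 2 * frobSq A
      - 2 * Matrix.trace (S * B * Aᵀ) + c * frobSq B := by
    intro A B
    have e : Z * (G * B) * (F * A)ᵀ = F * (S * B * Aᵀ * Fᵀ) := by

      rw [hZ, Matrix.transpose_mul]
      simp only [Matrix.mul_assoc]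
      rw [← Matrix.mul_assoc Gᵀ G, hG, Matrix.one_mul]
    rw [hQ, frobSq_orth F hF, frobSq_orth G hG, e, Matrix.trace_mul_comm, Matrix.mul_assoc, hF,
      Matrix.mul_one]
  have main : (∀ ΔU ΔV, 0 ≤ Q ΔU ΔV) ↔ ζ 0 ^ 2 ≤ σ ^ 2 * c := by
    constructor
    · intro h
      let i2 : Fin d2 := ⟨0, hd2⟩
      let i1 : Fin d1 := ⟨0, hd1⟩
      let i0 : Fin d0 := ⟨0, hd0⟩
      have h0 := h (F * Matrix.single i2 i1 (ζ 0)) (G * Matrix.single i0 i1 (σ ^ 2))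
      rw [key, frobSq_eq_trace, frobSq_eq_trace, Matrix.transpose_single, Matrix.transpose_single,
        Matrix.mul_assoc] at h0
      simp [Matrix.trace_mul_single, hS, i0, i1, i2] at h0
      have : 0 ≤ σ ^ 2 * (σ ^ 2 * c - ζ 0 ^ 2) := by nlinarith
      have := nonneg_of_mul_nonneg_right this hs
      linarith
    · intro h U V
      have hU : U = F * (Fᵀ * U) := by rw [← Matrix.mul_assoc, hF', Matrix.one_mul]
      have hV : V = G * (Gᵀ * V) := by rw [← Matrix.mul_assoc, hG', Matrix.one_mul]
      rw [hU, hV, key]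
      generalize Fᵀ * U = A
      generalize Gᵀ * V = B
      have hb : ∀ i, ∀ x y : ℝ, 2 * (ζ i * y * x) ≤ σ ^ 2 * x ^ 2 + c * y ^ 2 := by
        intro i x y
        have hi : ζ i ^ 2 ≤ σ ^ 2 * c :=
          le_trans (pow_le_pow_left₀ (hζnn i) (hζmono 0 i (Nat.zero_le i)) 2) h
        have : 0 ≤ σ ^ 2 * (σ ^ 2 * x ^ 2 + c * y ^ 2 - 2 * (ζ i * y * x)) := by
          nlinarith [sq_nonneg (σ ^ 2 * x - ζ i * y), mul_nonneg (sub_nonneg.2 hi) (sq_nonneg y)]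
        have := nonneg_of_mul_nonneg_right this hs
        linarith
      have hk := Finset.sum_le_sum fun (k : Fin d1) (_ : k ∈ Finset.univ) =>
        diag_bound ζ (σ ^ 2) c hs.le hcpos.le hb (fun i => A i k) (fun j => B j k)
      rw [Finset.sum_add_distrib, ← Finset.mul_sum, ← Finset.mul_sum, ← Finset.mul_sum,
        Finset.sum_comm, Finset.sum_comm (f := fun k i => A i k ^ 2),
        Finset.sum_comm (f := fun k i => B i k ^ 2)] at hk
      have ht : Matrix.trace (S * B * Aᵀ) = ∑ i : Fin d2, ∑ k : Fin d1,
          (∑ j : Fin d0, (if (i : ℕ) = (j : ℕ) then ζ i else 0) * B j k) * A i k := by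
        simp only [hS, Matrix.trace, Matrix.diag, Matrix.mul_apply, Matrix.transpose_apply,
          Matrix.of_apply]
      rw [ht]
      unfold frobSq
      linarith
  refine ⟨main, main.trans ?_⟩
  rw [sub_nonneg, Real.sqrt_le_left (by positivity)]
  constructor <;> intro h <;> nlinarith
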